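/- Let F be a totally real number field of degree N over ℚ with class number one. There exists a constant C > 0, depending only on F, such that for every CM-field K whose maximal totally real subfield is F, every principal prime ideal 𝔭 of O_K whose absolute norm N𝔭 is a rational prime p satisfies p ≥ C·Δ_K. -/

import Mathlib

open NumberField

/-- If `z` is a non-real root of a monic real quadratic polynomial, then the value of the
derivative at `z` is `z - conj z`, hence is bounded by `2 * ‖z‖`. -/
lemma Complex.norm_two_mul_add_le_of_root {z b c : ℂ} (hb : b.im = 0) (hc : c.im = 0)
    (hz : z.im ≠ 0) (h : z ^ 2 + b * z + c = 0) : ‖2 * z + b‖ ≤ 2 * ‖z‖ := by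
  have him := congrArg Complex.im h
  simp only [pow_two, Complex.add_im, Complex.mul_im, hb, hc, Complex.zero_im] at him
  have hre : b.re = -(2 * z.re) := by
    apply mul_right_cancel₀ hz
    linarith
  have key : 2 * z + b = z - (starRingEnd ℂ) z := by
    apply Complex.ext
    · simp [hre]
    · simp [hb]
      ring
  rw [key]
  calc ‖z - (starRingEnd ℂ) z‖ ≤ ‖z‖ + ‖(starRingEnd ℂ) z‖ := norm_sub_le _ _
    _ = 2 * ‖z‖ := by rw [RCLike.norm_conj]; ring

section Quadratic

variable {F K : Type*} [Field F] [Field K] [Algebra F K]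

lemma im_ne_zero_of_adjoin_eq_top (hF : ∀ φ : F →+* ℂ, ∀ z : F, (φ z).im = 0)
    (hK : IsEmpty (K →+* ℝ)) {x : K} (hx : Algebra.adjoin F {x} = ⊤) (φ : K →+* ℂ) :
    (φ x).im ≠ 0 := by
  intro him
  have hreal : ∀ y : K, φ y ∈ Complex.ofRealHom.range := by
    intro y
    have hy : y ∈ Algebra.adjoin F {x} := hx ▸ Algebra.mem_top
    induction hy using Algebra.adjoin_induction with
    | mem y hy =>
      obtain rfl : y = x := hy
      exact ⟨(φ y).re, Complex.ext (by simp) (by simp [him])⟩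
    | algebraMap r =>
      exact ⟨(φ (algebraMap F K r)).re,
        Complex.ext (by simp) (by simpa using (hF (φ.comp (algebraMap F K)) r).symm)⟩
    | add y z _ _ hy hz => rw [map_add]; exact add_mem hy hz
    | mul y z _ _ hy hz => rw [map_mul]; exact mul_mem hy hz
  let e := RingEquiv.ofLeftInverse (f := Complex.ofRealHom) (g := Complex.re) Complex.ofReal_re
  exact hK.false ((e.symm : Complex.ofRealHom.range →+* ℝ).comp (φ.codRestrict _ hreal))

lemma norm_aeval_derivative_minpoly_le (hF : ∀ φ : F →+* ℂ, ∀ z : F, (φ z).im = 0)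
    (hK : IsEmpty (K →+* ℝ)) (h2 : Module.finrank F K = 2) {x : K}
    (hx : Algebra.adjoin F {x} = ⊤) (φ : K →+* ℂ) :
    ‖φ (Polynomial.aeval x (Polynomial.derivative (minpoly F x)))‖ ≤ 2 * ‖φ x‖ := by
  have : FiniteDimensional F K := FiniteDimensional.of_finrank_pos (by omega)
  have hx_int : IsIntegral F x := Algebra.IsIntegral.isIntegral x
  have hdeg : (minpoly F x).natDegree = 2 := by
    rw [← h2, ← Field.primitive_element_iff_minpoly_natDegree_eq,
      IntermediateField.adjoin_simple_eq_top_iff_of_isAlgebraic hx_int.isAlgebraic, hx]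
  have hmonic : (minpoly F x).coeff 2 = 1 := hdeg ▸ (minpoly.monic hx_int).coeff_natDegree
  have hquad := Polynomial.eq_quadratic_of_degree_le_two
    (Polynomial.natDegree_le_iff_degree_le.mp hdeg.le)
  rw [hmonic] at hquad
  set b := (minpoly F x).coeff 1
  set c := (minpoly F x).coeff 0
  have hroot : x ^ 2 + algebraMap F K b * x + algebraMap F K c = 0 := by
    have h := minpoly.aeval F x
    rw [hquad] at h
    simpa using h
  have hder : Polynomial.aeval x (Polynomial.derivative (minpoly F x)) =
      2 * x + algebraMap F K b := by
    rw [hquad]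
    simp [one_add_one_eq_two, map_ofNat (algebraMap F K) 2]
  rw [hder, map_add, map_mul, map_ofNat]
  refine Complex.norm_two_mul_add_le_of_root (hF (φ.comp (algebraMap F K)) b)
    (hF (φ.comp (algebraMap F K)) c) (im_ne_zero_of_adjoin_eq_top hF hK hx φ) ?_
  simpa using congrArg φ hroot

lemma Algebra.adjoin_singleton_eq_top_of_finrank_eq_two (h2 : Module.finrank F K = 2) {x : K}
    (hx : x ∉ (algebraMap F K).range) : Algebra.adjoin F {x} = ⊤ := by
  have := Subalgebra.isSimpleOrder_of_finrank_prime F K (h2 ▸ Nat.prime_two)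
  refine (eq_bot_or_eq_top _).resolve_left fun h ↦ hx ?_
  obtain ⟨y, hy⟩ := Algebra.mem_bot.mp (h ▸ Algebra.self_mem_adjoin_singleton F x)
  exact ⟨y, hy⟩

end Quadratic

namespace NumberField

variable {K : Type*} [Field K] [NumberField K]

lemma natAbs_norm_le_of_forall_embedding {x y : 𝓞 K} {r : ℝ}
    (h : ∀ φ : K →+* ℂ, ‖φ x‖ ≤ r * ‖φ y‖) :
    ((Algebra.norm ℤ x).natAbs : ℝ) ≤
      r ^ Module.finrank ℚ K * ((Algebra.norm ℤ y).natAbs : ℝ) := by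
  have hprod (z : 𝓞 K) : ((Algebra.norm ℤ z).natAbs : ℝ) =
      ∏ w : InfinitePlace K, w (z : K) ^ w.mult := by
    rw [InfinitePlace.prod_eq_abs_norm, ← Algebra.coe_norm_int, Nat.cast_natAbs]
    simp
  rw [hprod, hprod, ← InfinitePlace.sum_mult_eq, ← Finset.prod_pow_eq_pow_sum,
    ← Finset.prod_mul_distrib]
  refine Finset.prod_le_prod (fun _ _ ↦ by positivity) fun w _ ↦ ?_
  rw [← mul_pow, ← InfinitePlace.norm_embedding_eq, ← InfinitePlace.norm_embedding_eq]
  gcongr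
  exact h w.embedding

variable {F : Type*} [Field F] [NumberField F] [Algebra F K]

/-- The relative different divides the derivative of `f` at `x`, for `x` an integral generator
with minimal polynomial `f`; in terms of absolute discriminants. -/
lemma natAbs_discr_le_of_adjoin_eq_top {x : 𝓞 K} (hx : Algebra.adjoin F {(x : K)} = ⊤) :
    (discr K).natAbs ≤
      (Algebra.norm ℤ (Polynomial.aeval x (Polynomial.derivative (minpoly (𝓞 F) x)))).natAbs *
        (discr F).natAbs ^ Module.finrank F K := by
  have hK : Module.Finite F K := Module.Finite.of_restrictScalars_finite ℚ F K
  have hx_int : IsIntegral (𝓞 F) x := Algebra.IsIntegral.isIntegral x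
  set δ := Polynomial.aeval x (Polynomial.derivative (minpoly (𝓞 F) x)) with hδ
  have hmem : δ ∈ differentIdeal (𝓞 F) (𝓞 K) :=
    aeval_derivative_mem_differentIdeal (𝓞 F) F K x hx
  have hsep : (minpoly F (x : K)).Separable := Algebra.IsSeparable.isSeparable F (x : K)
  have hδ0 : δ ≠ 0 := by
    intro h0
    refine hsep.aeval_derivative_ne_zero (minpoly.aeval F (x : K)) ?_
    rw [minpoly.isIntegrallyClosed_eq_field_fractions F K hx_int, Polynomial.derivative_map,
      Polynomial.aeval_map_algebraMap, Polynomial.aeval_algebraMap_apply, ← hδ, h0, map_zero]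
  rw [natAbs_discr_eq_absNorm_differentIdeal_mul_natAbs_discr_pow F (𝓞 F) K (𝓞 K),
    ← Ideal.absNorm_span_singleton]
  refine Nat.mul_le_mul_right _ (Nat.le_of_dvd ?_ (Ideal.absNorm_dvd_absNorm_of_le
    ((Ideal.span_singleton_le_iff_mem _).mpr hmem)))
  rw [Ideal.absNorm_span_singleton, Int.natAbs_pos]
  exact Algebra.norm_ne_zero_iff.mpr hδ0

lemma not_mem_range_of_prime_natAbs_norm (h2 : Module.finrank F K = 2) {x : 𝓞 K}
    (hx : (Algebra.norm ℤ x).natAbs.Prime) : (x : K) ∉ (algebraMap F K).range := by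
  rintro ⟨y, hy⟩
  have hyint : IsIntegral ℤ y := by
    rw [← isIntegral_algebraMap_iff (algebraMap F K).injective, hy]
    exact x.isIntegral_coe
  let y' : 𝓞 F := ⟨y, hyint⟩
  have hnorm : Algebra.norm ℤ x = Algebra.norm ℤ y' ^ 2 := by
    have hQ : (Algebra.norm ℤ x : ℚ) = (Algebra.norm ℤ y' : ℚ) ^ 2 := by
      rw [Algebra.coe_norm_int, Algebra.coe_norm_int, ← hy,
        ← Algebra.norm_norm (S := F), Algebra.norm_algebraMap, h2, map_pow]
      rfl
    exact_mod_cast hQ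
  rw [hnorm, Int.natAbs_pow] at hx
  exact Nat.Prime.not_prime_pow le_rfl hx

end NumberField

/-- let `F` be a totally real number field of degree `N` over `ℚ` with class
number one. There is a constant `C > 0` depending only on `F` such that for every CM-field
`K` with maximal totally real subfield `F` (i.e. `K/F` quadratic and `K` totally imaginary),
every principal prime ideal `𝔭` of `O_K` whose absolute norm is a rational prime `p`
satisfies `p ≥ C·Δ_K`. -/
theorem stmt_7.{u, v} (F : Type u) [Field F] [NumberField F] (N : ℕ)
    (hN : Module.finrank ℚ F = N)
    (hTR : ∀ φ : F →+* ℂ, ∀ z : F, (φ z).im = 0)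
    (hcl : NumberField.classNumber F = 1) :
    ∃ C : ℝ, 0 < C ∧
      ∀ (K : Type v) [Field K] [NumberField K] [Algebra F K],
        Module.finrank F K = 2 →
        IsEmpty (K →+* ℝ) →
        ∀ 𝔭 : Ideal (𝓞 K), 𝔭.IsPrime → Submodule.IsPrincipal 𝔭 →
          (Ideal.absNorm 𝔭).Prime →
          C * ((NumberField.discr K).natAbs : ℝ) ≤ (Ideal.absNorm 𝔭 : ℝ) := by
  have hD : (0 : ℝ) < (discr F).natAbs := by
    exact_mod_cast Int.natAbs_pos.mpr (discr_ne_zero F)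
  refine ⟨(2 ^ (N * 2) * ((discr F).natAbs : ℝ) ^ 2)⁻¹, by positivity, ?_⟩
  intro K _ _ _ h2 hK 𝔭 _ hprinc hp
  obtain ⟨x, rfl⟩ := hprinc
  rw [Ideal.submodule_span_eq, Ideal.absNorm_span_singleton] at hp ⊢
  have hx := Algebra.adjoin_singleton_eq_top_of_finrank_eq_two h2
    (not_mem_range_of_prime_natAbs_norm h2 hp)
  set δ := Polynomial.aeval x (Polynomial.derivative (minpoly (𝓞 F) x))
  have hx_int : IsIntegral (𝓞 F) x := Algebra.IsIntegral.isIntegral x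
  have hδK : (δ : K) = Polynomial.aeval (x : K) (Polynomial.derivative (minpoly F (x : K))) := by
    rw [minpoly.isIntegrallyClosed_eq_field_fractions F K hx_int,
      Polynomial.derivative_map, Polynomial.aeval_map_algebraMap,
      Polynomial.aeval_algebraMap_apply]
  have hnorm := natAbs_norm_le_of_forall_embedding (x := δ) (y := x) (r := 2) fun φ ↦ by
    rw [hδK]
    exact norm_aeval_derivative_minpoly_le hTR hK h2 hx φ
  rw [← Module.finrank_mul_finrank ℚ F K, hN, h2] at hnorm
  have hdiscr : ((discr K).natAbs : ℝ) ≤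
      (Algebra.norm ℤ δ).natAbs * ((discr F).natAbs : ℝ) ^ 2 := by
    rw [← h2]
    exact_mod_cast natAbs_discr_le_of_adjoin_eq_top hx
  rw [inv_mul_le_iff₀ (by positivity)]
  calc ((discr K).natAbs : ℝ)
      ≤ (Algebra.norm ℤ δ).natAbs * ((discr F).natAbs : ℝ) ^ 2 := hdiscr
    _ ≤ (2 ^ (N * 2) * (Algebra.norm ℤ x).natAbs) * ((discr F).natAbs : ℝ) ^ 2 := by gcongr
    _ = 2 ^ (N * 2) * ((discr F).natAbs : ℝ) ^ 2 * (Algebra.norm ℤ x).natAbs := by ring
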